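/- Let k be an algebraically closed field of characteristic p = 3 and let R = k⟦x,y,z⟧/(z^2 + x^3 + xy^3) (the rational double point of type E_7^0 in characteristic 3). With L and A as in the context: (i) the image of z/(xy) in L does not lie in A; (ii) (z/(xy))^3 lies in A; (iii) for every c ∈ L such that c^{3^m} ∈ A for some m ≥ 0, there exists a ∈ k such that c − a·(z/(xy)) ∈ A. In other words, H^2_m(R)[F^∞] is the one-dimensional k-vector space spanned by the class of z/(xy), annihilated by Frobenius. -/

import Mathlib

set_option maxHeartbeats 1000000
set_option synthInstance.maxHeartbeats 400000

open MvPowerSeries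

noncomputable section

variable (k : Type) [Field k]

/-- The formal power series ring `k⟦x,y,z⟧`. -/
abbrev PS := MvPowerSeries (Fin 3) k

/-- The hypersurface singularity `R = k⟦x,y,z⟧/(f)`. -/
abbrev Rq (f : PS k) : Type := PS k ⧸ Ideal.span {f}

/-- The image of `x` in `R`. -/
abbrev xR (f : PS k) : Rq k f := Ideal.Quotient.mk _ (X 0)
/-- The image of `y` in `R`. -/
abbrev yR (f : PS k) : Rq k f := Ideal.Quotient.mk _ (X 1)
/-- The image of `z` in `R`. -/
abbrev zR (f : PS k) : Rq k f := Ideal.Quotient.mk _ (X 2)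

/-- `L`: the localization of `R` inverting `x*y`. -/
abbrev Lloc (f : PS k) : Type := Localization.Away (xR k f * yR k f)

/-- The canonical map from the localization of `R` inverting `x` to `L`. -/
noncomputable def phiX (f : PS k) : Localization.Away (xR k f) →+* Lloc k f :=
  IsLocalization.Away.awayToAwayRight (S := Localization.Away (xR k f)) (P := Lloc k f)
    (xR k f) (yR k f)

/-- The canonical map from the localization of `R` inverting `y` to `L`. -/
noncomputable def phiY (f : PS k) : Localization.Away (yR k f) →+* Lloc k f :=
  IsLocalization.Away.awayToAwayLeft (S := Localization.Away (yR k f)) (P := Lloc k f)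
    (yR k f) (xR k f)

/-- `A ⊆ L`: the `R`-submodule generated by the images of `R_x` and `R_y` in `L`.
The quotient `L/A` is a Čech description of the local cohomology `H^2_m(R)`. -/
def Asub (f : PS k) : Submodule (Rq k f) (Lloc k f) :=
  Submodule.span (Rq k f) (Set.range (phiX k f) ∪ Set.range (phiY k f))

/-- The element `z/(x*y) ∈ L`. -/
noncomputable def zxy (f : PS k) : Lloc k f :=
  Localization.mk (zR k f) ⟨xR k f * yR k f, Submonoid.mem_powers _⟩

/-- The element `f_j := z/(x*y^j) = z*x^(j-1)/(x*y)^j ∈ L` (for `j ≥ 1`). -/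
noncomputable def fcls (f : PS k) (j : ℕ) : Lloc k f :=
  Localization.mk (zR k f * xR k f ^ (j - 1)) ⟨(xR k f * yR k f) ^ j, j, rfl⟩

/-- The defining equation of the rational double point of type E7p0 in characteristic 3. -/
abbrev fRDP : PS k := X 2 ^ 2 + X 0 ^ 3 + X 0 * X 1 ^ 3

namespace E7

variable {k}

/-- The exponent vector `(i, j, l)`. -/
def expo (i j l : ℕ) : Fin 3 →₀ ℕ := Finsupp.equivFunOnFinite.symm ![i, j, l]

@[simp] lemma expo_zero (i j l : ℕ) : expo i j l 0 = i := rfl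
@[simp] lemma expo_one (i j l : ℕ) : expo i j l 1 = j := rfl
@[simp] lemma expo_two (i j l : ℕ) : expo i j l 2 = l := rfl

lemma finsupp_ext_fin_three {m n : Fin 3 →₀ ℕ} (h0 : m 0 = n 0) (h1 : m 1 = n 1)
    (h2 : m 2 = n 2) : m = n := by
  ext t
  fin_cases t <;> assumption

lemma expo_apply (m : Fin 3 →₀ ℕ) : expo (m 0) (m 1) (m 2) = m :=
  finsupp_ext_fin_three rfl rfl rfl

/-- The coefficient of `x^i y^j z^l`. -/
def cf (i j l : ℕ) : PS k →ₗ[k] k := coeff (expo i j l)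

lemma cf_X0_pow_mul (n i j l : ℕ) (g : PS k) :
    cf i j l (X 0 ^ n * g) = if n ≤ i then cf (i - n) j l g else 0 := by
  rw [cf, X_pow_eq, coeff_monomial_mul]
  simp only [Finsupp.single_le_iff, expo_zero, one_mul]
  congr 2
  exact congrArg _ (finsupp_ext_fin_three (by simp) (by simp) (by simp))

lemma cf_X1_pow_mul (n i j l : ℕ) (g : PS k) :
    cf i j l (X 1 ^ n * g) = if n ≤ j then cf i (j - n) l g else 0 := by
  rw [cf, X_pow_eq, coeff_monomial_mul]
  simp only [Finsupp.single_le_iff, expo_one, one_mul]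
  congr 2
  exact congrArg _ (finsupp_ext_fin_three (by simp) (by simp) (by simp))

lemma cf_X2_pow_mul (n i j l : ℕ) (g : PS k) :
    cf i j l (X 2 ^ n * g) = if n ≤ l then cf i j (l - n) g else 0 := by
  rw [cf, X_pow_eq, coeff_monomial_mul]
  simp only [Finsupp.single_le_iff, expo_two, one_mul]
  congr 2
  exact congrArg _ (finsupp_ext_fin_three (by simp) (by simp) (by simp))

lemma cf_C_mul (a : k) (i j l : ℕ) (g : PS k) : cf i j l (C a * g) = a * cf i j l g := by
  simp [cf]

lemma cf_one (i j l : ℕ) :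
    cf i j l (1 : PS k) = if i = 0 ∧ j = 0 ∧ l = 0 then 1 else 0 := by
  classical
  rw [cf, coeff_one]
  refine if_congr ⟨fun h => ?_, fun h => ?_⟩ rfl rfl
  · exact ⟨by simpa using DFunLike.congr_fun h 0, by simpa using DFunLike.congr_fun h 1,
      by simpa using DFunLike.congr_fun h 2⟩
  · exact finsupp_ext_fin_three h.1 h.2.1 h.2.2

/-- In characteristic `3`, cubing a power series cubes coefficients and triples exponents. -/
lemma cf_cube [CharP k 3] (i j l : ℕ) (g : PS k) :
    cf (3 * i) (3 * j) (3 * l) (g ^ 3) = cf i j l g ^ 3 := by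
  have : Fact (Nat.Prime 3) := ⟨Nat.prime_three⟩
  rw [← map_frobenius_expand 3 three_ne_zero, cf, coeff_map, cf]
  have h : expo (3 * i) (3 * j) (3 * l) = 3 • expo i j l :=
    finsupp_ext_fin_three (by simp) (by simp) (by simp)
  rw [h, coeff_expand_smul, frobenius_def]

lemma cf_cube_eq_zero [CharP k 3] (i j l : ℕ) (g : PS k)
    (h : ¬ (3 ∣ i ∧ 3 ∣ j ∧ 3 ∣ l)) : cf i j l (g ^ 3) = 0 := by
  have : Fact (Nat.Prime 3) := ⟨Nat.prime_three⟩
  rw [← map_frobenius_expand 3 three_ne_zero, cf, coeff_map]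
  have : ∃ t : Fin 3, ¬ 3 ∣ expo i j l t := by
    by_contra! H
    exact h ⟨H 0, H 1, H 2⟩
  obtain ⟨t, ht⟩ := this
  rw [coeff_expand_of_not_dvd 3 three_ne_zero g ht, map_zero]

lemma cf_eq_zero_of_pos (g : PS k) (hg : ∀ i j l, cf i j (l + 1) g = 0) (i j l : ℕ)
    (hl : l ≠ 0) : cf i j l g = 0 := by
  obtain ⟨l, rfl⟩ := Nat.exists_eq_succ_of_ne_zero hl
  exact hg i j l

lemma cf_cube_eq_zero_of_pos [CharP k 3] (g : PS k) (hg : ∀ i j l, cf i j (l + 1) g = 0)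
    (i j l : ℕ) (hl : l ≠ 0) : cf i j l (g ^ 3) = 0 := by
  by_cases hd : 3 ∣ i ∧ 3 ∣ j ∧ 3 ∣ l
  · obtain ⟨⟨i, rfl⟩, ⟨j, rfl⟩, ⟨l, rfl⟩⟩ := hd
    rw [cf_cube, cf_eq_zero_of_pos g hg _ _ _ (by omega), zero_pow three_ne_zero]
  · exact cf_cube_eq_zero _ _ _ _ hd

/-- A power series whose coefficients vanish in the box `i, j < n` lies in `(x^n, y^n)`. -/
lemma exists_eq_of_cf_eq_zero (n : ℕ) (g : PS k)
    (h : ∀ i < n, ∀ j < n, ∀ l, cf i j l g = 0) :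
    ∃ u v : PS k, g = X 0 ^ n * u + X 1 ^ n * v := by
  classical
  let g1 : PS k := fun m => if n ≤ m 0 then coeff m g else 0
  have hc : ∀ m, coeff m g1 = if n ≤ m 0 then coeff m g else 0 := fun _ => rfl
  have h1 : (X 0 : PS k) ^ n ∣ g1 := by
    rw [X_pow_dvd_iff]
    intro m hm
    rw [hc, if_neg (by omega)]
  have h2 : (X 1 : PS k) ^ n ∣ g - g1 := by
    rw [X_pow_dvd_iff]
    intro m hm
    rw [map_sub, hc]
    split_ifs with h0
    · simp
    · have := h (m 0) (by omega) (m 1) hm (m 2)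
      rw [cf, expo_apply] at this
      simp [this]
  obtain ⟨u, hu⟩ := h1
  obtain ⟨v, hv⟩ := h2
  exact ⟨u, v, by rw [← hu, ← hv]; ring⟩

/-- Splitting off the part of a power series not involving `z`. -/
lemma exists_eq_add_X2_mul (g : PS k) :
    ∃ a h : PS k, (∀ i j l, cf i j (l + 1) a = 0) ∧ g = a + X 2 * h := by
  classical
  let a : PS k := fun m => if m 2 = 0 then coeff m g else 0
  have hc : ∀ m, coeff m a = if m 2 = 0 then coeff m g else 0 := fun _ => rfl
  have h1 : (X 2 : PS k) ∣ g - a := by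
    rw [X_dvd_iff]
    intro m hm
    rw [map_sub, hc, if_pos hm, sub_self]
  obtain ⟨h, hh⟩ := h1
  refine ⟨a, h, fun i j l => ?_, by rw [← hh]; ring⟩
  rw [cf, hc, if_neg (by simp)]

/-- Division by `z^2 + x^3 + x y^3`, modulo a power of `x`. -/
lemma exists_normal_form (n : ℕ) (g : PS k) :
    ∃ a b h q : PS k, (∀ i j l, cf i j (l + 1) a = 0) ∧ (∀ i j l, cf i j (l + 1) b = 0) ∧
      g = a + b * X 2 + X 0 ^ n * h + fRDP k * q := by
  induction n with
  | zero => exact ⟨0, 0, g, 0, by simp, by simp, by ring⟩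
  | succ n ih =>
    obtain ⟨a, b, h, q, ha, hb, hg⟩ := ih
    obtain ⟨a1, h1, ha1, rfl⟩ := exists_eq_add_X2_mul h
    obtain ⟨b1, h2, hb1, rfl⟩ := exists_eq_add_X2_mul h1
    have key : ∀ a1 : PS k, (∀ i j l, cf i j (l + 1) a1 = 0) →
        ∀ i j l, cf i j (l + 1) (X 0 ^ n * a1) = 0 := by
      intro a1 ha1 i j l
      rw [cf_X0_pow_mul, ha1, ite_self]
    refine ⟨a + X 0 ^ n * a1, b + X 0 ^ n * b1, -(X 0 ^ 2 + X 1 ^ 3) * h2, q + X 0 ^ n * h2,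
      fun i j l => ?_, fun i j l => ?_, ?_⟩
    · rw [map_add, ha, key a1 ha1, add_zero]
    · rw [map_add, hb, key b1 hb1, add_zero]
    · rw [hg, fRDP]; ring

lemma cf_fRDP_mul (i j l : ℕ) (w : PS k) :
    cf i j l (fRDP k * w) = (if 2 ≤ l then cf i j (l - 2) w else 0) +
      (if 3 ≤ i then cf (i - 3) j l w else 0) +
      (if 1 ≤ i then if 3 ≤ j then cf (i - 1) (j - 3) l w else 0 else 0) := by
  have h : fRDP k * w = X 2 ^ 2 * w + X 0 ^ 3 * w + X 0 ^ 1 * (X 1 ^ 3 * w) := by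
    rw [fRDP]; ring
  rw [h, map_add, map_add, cf_X2_pow_mul, cf_X0_pow_mul, cf_X0_pow_mul, cf_X1_pow_mul]

/-- A power series of `z`-degree at most one lying in `(x^N, y^N, f)` lies in `(x^N, y^N)`. -/
lemma cf_eq_zero_of_mem (N : ℕ) (G u v w : PS k) (hG : ∀ i j l, cf i j (l + 2) G = 0)
    (h : G = X 0 ^ N * u + X 1 ^ N * v + fRDP k * w) (i : ℕ) (hi : i < N) (j : ℕ) (hj : j < N)
    (l : ℕ) : cf i j l G = 0 := by
  have key : ∀ i < N, ∀ j < N, ∀ l, cf i j l G = cf i j l (fRDP k * w) := by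
    intro i hi j hj l
    rw [h, map_add, map_add, cf_X0_pow_mul, cf_X1_pow_mul, if_neg (by omega), if_neg (by omega)]
    simp
  have hw : ∀ i < N, ∀ j < N, ∀ l, cf i j l w = 0 := by
    intro i
    induction i using Nat.strong_induction_on with
    | _ i ih =>
      intro hi j hj l
      have h1 := key i hi j hj (l + 2)
      rw [hG, cf_fRDP_mul, if_pos (by omega), Nat.add_sub_cancel] at h1
      have h2 : (if 3 ≤ i then cf (i - 3) j (l + 2) w else 0) = 0 := by
        split_ifs with h3
        · exact ih _ (by omega) (by omega) _ hj _
        · rfl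
      have h4 : (if 1 ≤ i then if 3 ≤ j then cf (i - 1) (j - 3) (l + 2) w else 0 else 0) = 0 := by
        split_ifs with h3
        · exact ih _ (by omega) (by omega) _ (by omega) _
        · rfl
        · rfl
      rw [h2, h4, add_zero, add_zero] at h1
      exact h1.symm
  rw [key i hi j hj l, cf_fRDP_mul]
  have hz : ∀ a ≤ i, ∀ b ≤ j, ∀ l, cf a b l w = 0 :=
    fun a ha b hb l => hw a (by omega) b (by omega) l
  simp [hz]

/-- The canonical map from `k⟦x,y,z⟧` to `L`. -/
def toL : PS k →+* Lloc k (fRDP k) :=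
  (algebraMap (Rq k (fRDP k)) (Lloc k (fRDP k))).comp (Ideal.Quotient.mk _)

lemma toL_fRDP : toL (fRDP k) = 0 := by
  rw [toL, RingHom.comp_apply, Ideal.Quotient.eq_zero_iff_mem.2 (Ideal.mem_span_singleton_self _),
    map_zero]

lemma isUnit_toL_xy : IsUnit (toL (X 0 * X 1 : PS k)) :=
  IsLocalization.Away.algebraMap_isUnit (S := Lloc k (fRDP k))
    (xR k (fRDP k) * yR k (fRDP k))

lemma isUnit_toL_x : IsUnit (toL (X 0 : PS k)) := by
  have h := isUnit_toL_xy (k := k)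
  rw [map_mul] at h
  exact isUnit_of_mul_isUnit_left h

lemma isUnit_toL_y : IsUnit (toL (X 1 : PS k)) := by
  have h := isUnit_toL_xy (k := k)
  rw [map_mul] at h
  exact isUnit_of_mul_isUnit_right h

lemma exists_of_toL_eq {g h : PS k} (H : toL g = toL h) :
    ∃ (t : ℕ) (q : PS k), (X 0 * X 1) ^ t * g = (X 0 * X 1) ^ t * h + fRDP k * q := by
  obtain ⟨⟨_, t, rfl⟩, ht⟩ :=
    (IsLocalization.eq_iff_exists (Submonoid.powers (xR k (fRDP k) * yR k (fRDP k))) _).1 H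
  have h1 : Ideal.Quotient.mk (Ideal.span {fRDP k}) ((X 0 * X 1) ^ t * g) =
      Ideal.Quotient.mk _ ((X 0 * X 1) ^ t * h) := by
    rw [map_mul, map_mul _ _ h, map_pow, map_mul]
    exact ht
  obtain ⟨q, hq⟩ := Ideal.mem_span_singleton.1 (Ideal.Quotient.eq.1 h1)
  exact ⟨t, q, by rw [← hq]; ring⟩

lemma exists_toL_mul_eq (c : Lloc k (fRDP k)) :
    ∃ (n : ℕ) (g : PS k), toL (X 0 * X 1) ^ n * c = toL g := by
  obtain ⟨⟨r, ⟨_, n, rfl⟩⟩, h⟩ :=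
    IsLocalization.surj (Submonoid.powers (xR k (fRDP k) * yR k (fRDP k))) c
  obtain ⟨g, rfl⟩ := Ideal.Quotient.mk_surjective r
  refine ⟨n, g, ?_⟩
  rw [mul_comm]
  refine Eq.trans ?_ h
  rw [map_pow]
  rfl

lemma mk_smul (g : PS k) (c : Lloc k (fRDP k)) :
    (Ideal.Quotient.mk _ g : Rq k (fRDP k)) • c = toL g * c :=
  Algebra.smul_def (Ideal.Quotient.mk _ g : Rq k (fRDP k)) c

lemma exists_toL_of_mem {c : Lloc k (fRDP k)} (hc : c ∈ Asub k (fRDP k)) :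
    ∃ (N : ℕ) (r s : PS k), toL (X 0 * X 1) ^ N * c = toL (X 0 ^ N * r + X 1 ^ N * s) := by
  induction hc using Submodule.span_induction with
  | mem c hc =>
    rcases hc with ⟨d, rfl⟩ | ⟨d, rfl⟩
    · obtain ⟨⟨r, ⟨_, n, rfl⟩⟩, h⟩ :=
        IsLocalization.surj (Submonoid.powers (xR k (fRDP k))) d
      obtain ⟨g, rfl⟩ := Ideal.Quotient.mk_surjective r
      have h1 := congrArg (phiX k (fRDP k)) h
      simp only [map_mul, map_pow] at h1
      rw [phiX, IsLocalization.Away.awayToAwayRight_eq,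
        IsLocalization.Away.awayToAwayRight_eq] at h1
      refine ⟨n, 0, g, ?_⟩
      change _ * toL (X 0) ^ n = toL g at h1
      simp only [map_mul, map_add, map_pow, map_zero, ← h1, phiX]
      ring
    · obtain ⟨⟨r, ⟨_, n, rfl⟩⟩, h⟩ :=
        IsLocalization.surj (Submonoid.powers (yR k (fRDP k))) d
      obtain ⟨g, rfl⟩ := Ideal.Quotient.mk_surjective r
      have h1 := congrArg (phiY k (fRDP k)) h
      simp only [map_mul, map_pow] at h1
      rw [phiY, IsLocalization.Away.awayToAwayLeft_eq,
        IsLocalization.Away.awayToAwayLeft_eq] at h1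
      refine ⟨n, g, 0, ?_⟩
      change _ * toL (X 1) ^ n = toL g at h1
      simp only [map_mul, map_add, map_pow, map_zero, ← h1, phiY]
      ring
  | zero => exact ⟨0, 0, 0, by simp⟩
  | add c d _ _ hc hd =>
    obtain ⟨N, r, s, h⟩ := hc
    obtain ⟨M, r', s', h'⟩ := hd
    refine ⟨N + M, X 1 ^ M * r + X 1 ^ N * r', X 0 ^ M * s + X 0 ^ N * s', ?_⟩
    simp only [map_mul, map_add, map_pow] at h h' ⊢
    linear_combination (toL (X 0) * toL (X 1)) ^ M * h + (toL (X 0) * toL (X 1)) ^ N * h'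
  | smul a c _ hc =>
    obtain ⟨N, r, s, h⟩ := hc
    obtain ⟨g, rfl⟩ := Ideal.Quotient.mk_surjective a
    refine ⟨N, g * r, g * s, ?_⟩
    refine (congrArg _ (mk_smul g c)).trans ?_
    simp only [map_mul, map_add, map_pow] at h ⊢
    linear_combination toL g * h

lemma mem_of_toL_x {c : Lloc k (fRDP k)} {n : ℕ} {g : PS k} (h : toL (X 0) ^ n * c = toL g) :
    c ∈ Asub k (fRDP k) := by
  refine Submodule.subset_span (Or.inl ⟨IsLocalization.mk'
    (Localization.Away (xR k (fRDP k))) (Ideal.Quotient.mk _ g : Rq k (fRDP k))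
    (⟨xR k (fRDP k) ^ n, n, rfl⟩ : Submonoid.powers (xR k (fRDP k))), ?_⟩)
  refine (isUnit_toL_x.pow n).mul_left_cancel (Eq.trans ?_ h.symm)
  have h1 := IsLocalization.mk'_spec' (Localization.Away (xR k (fRDP k)))
    (Ideal.Quotient.mk _ g : Rq k (fRDP k))
    (⟨xR k (fRDP k) ^ n, n, rfl⟩ : Submonoid.powers (xR k (fRDP k)))
  have h2 := congrArg (phiX k (fRDP k)) h1
  rw [map_mul, map_pow, map_pow] at h2
  simp only [phiX, IsLocalization.Away.awayToAwayRight_eq] at h2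
  exact h2

lemma mem_of_toL_y {c : Lloc k (fRDP k)} {n : ℕ} {g : PS k} (h : toL (X 1) ^ n * c = toL g) :
    c ∈ Asub k (fRDP k) := by
  refine Submodule.subset_span (Or.inr ⟨IsLocalization.mk'
    (Localization.Away (yR k (fRDP k))) (Ideal.Quotient.mk _ g : Rq k (fRDP k))
    (⟨yR k (fRDP k) ^ n, n, rfl⟩ : Submonoid.powers (yR k (fRDP k))), ?_⟩)
  refine (isUnit_toL_y.pow n).mul_left_cancel (Eq.trans ?_ h.symm)
  have h1 := IsLocalization.mk'_spec' (Localization.Away (yR k (fRDP k)))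
    (Ideal.Quotient.mk _ g : Rq k (fRDP k))
    (⟨yR k (fRDP k) ^ n, n, rfl⟩ : Submonoid.powers (yR k (fRDP k)))
  have h2 := congrArg (phiY k (fRDP k)) h1
  rw [map_mul, map_pow, map_pow] at h2
  simp only [phiY, IsLocalization.Away.awayToAwayLeft_eq] at h2
  exact h2

lemma mem_of_toL {c : Lloc k (fRDP k)} {n : ℕ} {u v : PS k}
    (h : toL (X 0 * X 1) ^ n * c = toL (X 0 ^ n * u + X 1 ^ n * v)) :
    c ∈ Asub k (fRDP k) := by
  obtain ⟨e, he⟩ := (isUnit_toL_y (k := k).pow n).exists_right_inv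
  have h1 : e * toL u ∈ Asub k (fRDP k) :=
    mem_of_toL_y (n := n) (g := u) (by rw [← mul_assoc, he, one_mul])
  have h2 : c - e * toL u ∈ Asub k (fRDP k) := by
    refine mem_of_toL_x (n := n) (g := v) ((isUnit_toL_y.pow n).mul_left_cancel ?_)
    simp only [map_mul, map_add, map_pow] at h ⊢
    linear_combination h - toL (X 0) ^ n * toL u * he
  simpa using add_mem h2 h1

/-- Elements of `A` written with denominator `(xy)^n` have vanishing coefficients in the box. -/
lemma cf_eq_zero_of_mem_Asub {c : Lloc k (fRDP k)} (hc : c ∈ Asub k (fRDP k)) {n : ℕ}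
    {G u : PS k} (hG : ∀ i j l, cf i j (l + 2) G = 0)
    (h : toL (X 0 * X 1) ^ n * c = toL (G + X 0 ^ n * u)) (i : ℕ) (hi : i < n) (j : ℕ)
    (hj : j < n) (l : ℕ) : cf i j l G = 0 := by
  obtain ⟨N, r, s, hN⟩ := exists_toL_of_mem hc
  have h1 : toL ((X 0 * X 1) ^ N * (G + X 0 ^ n * u)) =
      toL ((X 0 * X 1) ^ n * (X 0 ^ N * r + X 1 ^ N * s)) := by
    rw [map_mul toL (_ ^ N), ← h, map_mul toL (_ ^ n), ← hN, map_pow toL _ N, map_pow toL _ n]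
    ring
  obtain ⟨t, q, hq⟩ := exists_of_toL_eq h1
  have h2 : X 0 ^ (t + N) * (X 1 ^ (t + N) * G) =
      X 0 ^ (t + N + n) * (X 1 ^ (t + n) * r - X 1 ^ (t + N) * u) +
      X 1 ^ (t + N + n) * (X 0 ^ (t + n) * s) + fRDP k * q := by
    linear_combination hq
  have h3 := cf_eq_zero_of_mem (t + N + n) _ _ _ _ (fun i j l => ?_) h2 (i + (t + N)) (by omega)
    (j + (t + N)) (by omega) l
  · simpa [cf_X0_pow_mul, cf_X1_pow_mul] using h3
  · simp [cf_X0_pow_mul, cf_X1_pow_mul, hG]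

lemma toL_mul_zxy : toL (X 0 * X 1) * zxy k (fRDP k) = toL (X 2) := by
  rw [zxy, Localization.mk_eq_mk', mul_comm]
  exact IsLocalization.mk'_spec (M := Submonoid.powers (xR k (fRDP k) * yR k (fRDP k)))
    (Lloc k (fRDP k)) (zR k (fRDP k)) ⟨_, Submonoid.mem_powers _⟩

lemma algebraMap_smul (a : k) (c : Lloc k (fRDP k)) :
    algebraMap k (Rq k (fRDP k)) a • c = toL (C a) * c :=
  mk_smul (C a) c

lemma toL_z_sq : toL (X 2 : PS k) ^ 2 =
    -(toL (X 0) ^ 3 + toL (X 0) * toL (X 1) ^ 3) := by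
  have h := toL_fRDP (k := k)
  simp only [fRDP, map_add, map_mul, map_pow] at h
  linear_combination h

lemma zxy_notMem : zxy k (fRDP k) ∉ Asub k (fRDP k) := by
  intro h
  have h1 := cf_eq_zero_of_mem_Asub h (n := 1) (G := X 2 ^ 1 * 1) (u := 0) (fun i j l => ?_)
    (by rw [pow_one, toL_mul_zxy]; simp) 0 one_pos 0 one_pos 1
  · rw [cf_X2_pow_mul, cf_one] at h1
    simp at h1
  · rw [cf_X2_pow_mul, cf_one]
    simp

lemma zxy_cube_mem : zxy k (fRDP k) ^ 3 ∈ Asub k (fRDP k) := by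
  refine mem_of_toL (n := 3) (u := -X 2) (v := -X 0 * X 2) ?_
  rw [← mul_pow, toL_mul_zxy, pow_succ, toL_z_sq]
  simp only [map_add, map_mul, map_pow, map_neg]
  ring

/-- A normal form for elements of `L` together with their cubes. -/
lemma exists_normal_form_L [CharP k 3] (c : Lloc k (fRDP k)) :
    ∃ (n : ℕ) (a b h : PS k), (∀ i j l, cf i j (l + 1) a = 0) ∧
      (∀ i j l, cf i j (l + 1) b = 0) ∧
      toL (X 0 * X 1) ^ (n + 1) * c = toL (a + X 2 * b + X 0 ^ (n + 1) * h) ∧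
      toL (X 0 * X 1) ^ (3 * n + 3) * c ^ 3 = toL ((a ^ 3 - X 2 ^ 1 * (X 0 ^ 3 * b ^ 3) -
        X 2 ^ 1 * (X 0 ^ 1 * (X 1 ^ 3 * b ^ 3))) + X 0 ^ (3 * n + 3) * h ^ 3) := by
  have : Fact (Nat.Prime 3) := ⟨Nat.prime_three⟩
  have : CharP (PS k) 3 := charP_of_injective_ringHom (f := C) C_injective 3
  obtain ⟨n, g, hg⟩ := exists_toL_mul_eq c
  obtain ⟨a, b, h, q, ha, hb, hn⟩ := exists_normal_form (n + 1) (X 0 * X 1 * g)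
  have h1 : toL (X 0 * X 1) ^ (n + 1) * c = toL (a + X 2 * b + X 0 ^ (n + 1) * h) := by
    rw [pow_succ', mul_assoc, hg, ← map_mul, hn, map_add, map_mul (toL) (fRDP k), toL_fRDP,
      zero_mul, add_zero, mul_comm b]
  refine ⟨n, a, b, h, ha, hb, h1, ?_⟩
  have h2 : toL (X 0 * X 1) ^ (3 * n + 3) * c ^ 3 =
      toL ((a + X 2 * b + X 0 ^ (n + 1) * h) ^ 3) := by
    rw [map_pow, ← h1]
    ring
  rw [h2, add_pow_char, add_pow_char]
  have h3 := toL_z_sq (k := k)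
  simp only [map_add, map_mul, map_pow, map_sub]
  linear_combination toL (X 2) * toL b ^ 3 * h3

lemma exists_sub_mem_of_cube_mem [CharP k 3] {c : Lloc k (fRDP k)}
    (hc : c ^ 3 ∈ Asub k (fRDP k)) :
    ∃ a : k, c - toL (C a) * zxy k (fRDP k) ∈ Asub k (fRDP k) := by
  obtain ⟨n, a, b, h, ha, hb, h1, h3⟩ := exists_normal_form_L c
  have key := cf_eq_zero_of_mem_Asub hc (fun i j l => ?_) h3
  · have ha0 : ∀ i < n + 1, ∀ j < n + 1, ∀ l, cf i j l a = 0 := by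
      intro i hi j hj l
      rcases Nat.eq_zero_or_pos l with rfl | hl
      · have := key (3 * i) (by omega) (3 * j) (by omega) (3 * 0)
        rw [map_sub, map_sub, cf_cube, cf_X2_pow_mul, cf_X2_pow_mul, if_neg (by omega),
          if_neg (by omega), sub_zero, sub_zero] at this
        exact pow_eq_zero_iff three_ne_zero |>.1 this
      · exact cf_eq_zero_of_pos a ha _ _ _ hl.ne'
    have hb0 : ∀ i < n + 1, ∀ j < n + 1, ∀ l, (i = n ∧ j = n ∧ l = 0) ∨ cf i j l b = 0 := by
      intro i hi j hj l
      rcases Nat.eq_zero_or_pos l with rfl | hl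
      swap
      · exact Or.inr (cf_eq_zero_of_pos b hb _ _ _ hl.ne')
      by_cases hin : i < n
      · have := key (3 * i + 3) (by omega) (3 * j) (by omega) 1
        rw [map_sub, map_sub, cf_cube_eq_zero _ _ _ a (by omega), cf_X2_pow_mul, cf_X2_pow_mul,
          if_pos le_rfl, if_pos le_rfl, cf_X0_pow_mul, cf_X0_pow_mul, cf_X1_pow_mul,
          cf_cube_eq_zero (3 * i + 3 - 1) _ _ b (by omega), if_pos (by omega),
          Nat.add_sub_cancel] at this
        have h0 := cf_cube i j 0 b
        simp only [ite_self, zero_sub, sub_zero, neg_eq_zero, Nat.sub_self] at this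
        rw [mul_zero, this] at h0
        exact Or.inr (pow_eq_zero_iff three_ne_zero |>.1 h0.symm)
      by_cases hjn : j < n
      · have := key (3 * i + 1) (by omega) (3 * j + 3) (by omega) 1
        rw [map_sub, map_sub, cf_cube_eq_zero _ _ _ a (by omega), cf_X2_pow_mul, cf_X2_pow_mul,
          if_pos le_rfl, if_pos le_rfl, cf_X0_pow_mul, cf_X0_pow_mul, cf_X1_pow_mul,
          cf_cube_eq_zero (3 * i + 1 - 3) _ _ b (by omega), if_pos (by omega : 1 ≤ 3 * i + 1),
          if_pos (by omega : 3 ≤ 3 * j + 3), Nat.add_sub_cancel, Nat.add_sub_cancel] at this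
        have h0 := cf_cube i j 0 b
        simp only [ite_self, zero_sub, sub_zero, neg_eq_zero, Nat.sub_self] at this
        rw [mul_zero, this] at h0
        exact Or.inr (pow_eq_zero_iff three_ne_zero |>.1 h0.symm)
      · exact Or.inl ⟨by omega, by omega, rfl⟩
    obtain ⟨u, v, huv⟩ := exists_eq_of_cf_eq_zero _ a ha0
    obtain ⟨u', v', huv'⟩ := exists_eq_of_cf_eq_zero (n + 1)
      (b - C (cf n n 0 b) * (X 0 ^ n * (X 1 ^ n * 1))) (fun i hi j hj l => by
        rw [map_sub, cf_C_mul, cf_X0_pow_mul, cf_X1_pow_mul, cf_one]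
        rcases hb0 i hi j hj l with ⟨rfl, rfl, rfl⟩ | h0
        · simp
        · rw [h0]
          split_ifs with h4 h5 h6
          · obtain ⟨h6, h7, rfl⟩ := h6
            have hi' : i = n := by omega
            have hj' : j = n := by omega
            rw [hi', hj'] at h0
            simp [h0]
          all_goals simp)
    refine ⟨cf n n 0 b, mem_of_toL (n := n + 1) (u := u + X 2 * u' + h) (v := v + X 2 * v') ?_⟩
    have h5 := toL_mul_zxy (k := k)
    have h6 := congrArg toL huv
    have h7 := congrArg toL huv'
    simp only [map_add, map_mul, map_pow, map_sub, map_one] at h1 h5 h6 h7 ⊢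
    linear_combination h1 + h6 + toL (X 2) * h7 -
      toL (C (cf n n 0 b)) * (toL (X 0) * toL (X 1)) ^ n * h5
  · rw [map_sub, map_sub, cf_X2_pow_mul, cf_X2_pow_mul, cf_cube_eq_zero_of_pos a ha _ _ _ (by omega),
      cf_X0_pow_mul, cf_X0_pow_mul, cf_X1_pow_mul, cf_cube_eq_zero_of_pos b hb _ _ _ (by omega),
      cf_cube_eq_zero_of_pos b hb _ _ _ (by omega)]
    simp

lemma cube_mem_of_cube_cube_mem [CharP k 3] {c : Lloc k (fRDP k)}
    (hc : (c ^ 3) ^ 3 ∈ Asub k (fRDP k)) : c ^ 3 ∈ Asub k (fRDP k) := by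
  obtain ⟨α, hα⟩ := exists_sub_mem_of_cube_mem hc
  obtain ⟨n, a, b, h, ha, hb, -, h3⟩ := exists_normal_form_L c
  have h4 : toL (X 0 * X 1) ^ (3 * n + 3) * (c ^ 3 - toL (C α) * zxy k (fRDP k)) =
      toL ((a ^ 3 - X 2 ^ 1 * (X 0 ^ 3 * b ^ 3) - X 2 ^ 1 * (X 0 ^ 1 * (X 1 ^ 3 * b ^ 3)) -
        C α * (X 2 ^ 1 * (X 0 ^ (3 * n + 2) * (X 1 ^ (3 * n + 2) * 1)))) +
        X 0 ^ (3 * n + 3) * h ^ 3) := by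
    have h5 := toL_mul_zxy (k := k)
    simp only [map_add, map_mul, map_pow, map_sub, map_one] at h3 h5 ⊢
    linear_combination h3 - toL (C α) * (toL (X 0) * toL (X 1)) ^ (3 * n + 2) * h5
  have h6 := cf_eq_zero_of_mem_Asub hα (fun i j l => ?_) h4 (3 * n + 2) (by omega) (3 * n + 2)
    (by omega) 1
  · rw [map_sub, map_sub, map_sub, cf_cube_eq_zero _ _ _ a (by omega), cf_X2_pow_mul,
      cf_X2_pow_mul, cf_X0_pow_mul, cf_X0_pow_mul, cf_X1_pow_mul,
      cf_cube_eq_zero _ _ _ b (by omega), cf_cube_eq_zero _ _ _ b (by omega), cf_C_mul,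
      cf_X2_pow_mul, cf_X0_pow_mul, cf_X1_pow_mul, cf_one] at h6
    have h7 : α = 0 := by simpa using h6
    simpa [h7] using hα
  · rw [map_sub, map_sub, map_sub, cf_cube_eq_zero_of_pos a ha _ _ _ (by omega), cf_X2_pow_mul,
      cf_X2_pow_mul, cf_X0_pow_mul, cf_X0_pow_mul, cf_X1_pow_mul,
      cf_cube_eq_zero_of_pos b hb _ _ _ (by omega), cf_cube_eq_zero_of_pos b hb _ _ _ (by omega),
      cf_C_mul, cf_X2_pow_mul, cf_X0_pow_mul, cf_X1_pow_mul, cf_one]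
    simp

end E7

/-- For the rational double point `R` of type E7p0 in characteristic 3,
the Frobenius-nilpotent part `H^2_m(R)[F^∞]` of local cohomology `L/A` is the one-dimensional
`k`-vector space spanned by the class of `z/(xy)`, and it is annihilated by Frobenius. -/
theorem localCohomology_E7p0 (k : Type) [Field k] [IsAlgClosed k] [CharP k 3] :
    -- (i) the image of z/(xy) in L does not lie in A
    zxy k (fRDP k) ∉ Asub k (fRDP k) ∧
    -- (ii) (z/(xy))^3 lies in A
    (zxy k (fRDP k)) ^ 3 ∈ Asub k (fRDP k) ∧
    -- (iii) every Frobenius-nilpotent class is a k-multiple of the class of z/(xy)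
    (∀ c : Lloc k (fRDP k), (∃ m : ℕ, c ^ 3 ^ m ∈ Asub k (fRDP k)) →
      ∃ a : k, c - algebraMap k (Rq k (fRDP k)) a • zxy k (fRDP k) ∈ Asub k (fRDP k)) := by
  have step : ∀ c : Lloc k (fRDP k), c ^ 9 ∈ Asub k (fRDP k) → c ^ 3 ∈ Asub k (fRDP k) :=
    fun c hc => E7.cube_mem_of_cube_cube_mem (by rwa [← pow_mul])
  refine ⟨E7.zxy_notMem, E7.zxy_cube_mem, ?_⟩
  rintro c ⟨m, hm⟩
  have hcases : c ∈ Asub k (fRDP k) ∨ c ^ 3 ∈ Asub k (fRDP k) := by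
    induction m with
    | zero => exact Or.inl (by simpa using hm)
    | succ m ih =>
      rcases m with _ | m
      · exact Or.inr (by simpa using hm)
      · refine ih ?_
        rw [pow_succ 3 m, pow_mul]
        refine step _ ?_
        rw [← pow_mul]
        convert hm using 2
        ring
  rcases hcases with h | h
  · exact ⟨0, by rw [E7.algebraMap_smul]; simpa using h⟩
  · obtain ⟨a, ha⟩ := E7.exists_sub_mem_of_cube_mem h
    exact ⟨a, by rwa [E7.algebraMap_smul]⟩
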